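/- Let N ≥ 2 be an integer, let μ be the Haar probability measure on U(N), and let X and Y be Hermitian operators on ℂ^N. Define g(U) := Y U X − U X U† Y U. Then (1/N) ∫_{U(N)} Tr( g(U)† g(U) ) dμ(U) = (2/(N²−1)) · Tr( (X − (Tr X / N)·1_N)² ) · Tr( (Y − (Tr Y / N)·1_N)² ). -/

import Mathlib

open Matrix MeasureTheory

noncomputable instance (n : Type*) [Fintype n] [DecidableEq n] :
    MeasurableSpace (Matrix.unitaryGroup n ℂ) := borel _

instance (n : Type*) [Fintype n] [DecidableEq n] :
    BorelSpace (Matrix.unitaryGroup n ℂ) := ⟨rfl⟩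

/-- The Riemannian gradient `g(U) = Y U X − U X U† Y U` of `E(U) = Tr (X U† Y U)`. -/
noncomputable def riemannGrad1 (N : ℕ) (X Y : Matrix (Fin N) (Fin N) ℂ)
    (U : Matrix.unitaryGroup (Fin N) ℂ) : Matrix (Fin N) (Fin N) ℂ :=
  Y * (U : Matrix (Fin N) (Fin N) ℂ) * X -
    (U : Matrix (Fin N) (Fin N) ℂ) * X * ((U : Matrix (Fin N) (Fin N) ℂ))ᴴ * Y *
      (U : Matrix (Fin N) (Fin N) ℂ)

lemma exists_perm_pair {n : Type*} [DecidableEq n] {i j k l : n} (hij : i ≠ j) (hkl : k ≠ l) :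
    ∃ σ : Equiv.Perm n, σ i = k ∧ σ j = l := by
  refine ⟨Equiv.swap (Equiv.swap i k j) l * Equiv.swap i k, ?_, by simp⟩
  have h : k ≠ Equiv.swap i k j := fun h ↦ hij <| (Equiv.swap i k).injective (by simpa using h)
  simp [Equiv.swap_apply_of_ne_of_ne h hkl]

lemma permMatrix_mem_unitaryGroup {n : Type*} [DecidableEq n] [Fintype n] (σ : Equiv.Perm n) :
    σ.permMatrix ℂ ∈ Matrix.unitaryGroup n ℂ := by
  rw [Matrix.mem_unitaryGroup_iff, star_eq_conjTranspose, conjTranspose_permMatrix,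
    ← permMatrix_mul, inv_mul_cancel, permMatrix_one]

lemma permMatrix_mul_single_mul_conjTranspose {n : Type*} [DecidableEq n] [Fintype n]
    (σ : Equiv.Perm n) (i j : n) (c : ℂ) :
    σ.permMatrix ℂ * single (σ i) (σ j) c * (σ.permMatrix ℂ)ᴴ = single i j c := by
  rw [conjTranspose_permMatrix, Equiv.Perm.permMatrix, Equiv.Perm.permMatrix,
    PEquiv.toMatrix_toPEquiv_mul, PEquiv.mul_toMatrix_toPEquiv, submatrix_submatrix]
  exact (submatrix_single_equiv σ σ _ _ _).trans (by simp)

/-- A bilinear form on matrices which is invariant under unitary conjugation restricts, on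
Hermitian matrices, to a combination of `(Tr Y)²` and `Tr Y²`. -/
lemma exists_apply_self_eq_of_unitary_invariant {n : Type*} [DecidableEq n] [Fintype n]
    [Nontrivial n] (B : Matrix n n ℂ →ₗ[ℂ] Matrix n n ℂ →ₗ[ℂ] ℂ)
    (hB : ∀ V ∈ Matrix.unitaryGroup n ℂ, ∀ Y Z, B (V * Y * Vᴴ) (V * Z * Vᴴ) = B Y Z) :
    ∃ a b : ℂ, ∀ Y : Matrix n n ℂ, Y.IsHermitian →
      B Y Y = a * Y.trace ^ 2 + b * (Y * Y).trace := by
  obtain ⟨i, j, hij⟩ := exists_pair_ne n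
  have hperm (σ : Equiv.Perm n) (k l : n) :
      B (single (σ k) (σ k) 1) (single (σ l) (σ l) 1) = B (single k k 1) (single l l 1) := by
    rw [← hB _ (permMatrix_mem_unitaryGroup σ)]
    simp only [permMatrix_mul_single_mul_conjTranspose]
  set p := B (single i i 1) (single i i 1) with hp
  set q := B (single i i 1) (single j j 1) with hq
  have hE (k l : n) : B (single k k 1) (single l l 1) = q + if k = l then p - q else 0 := by
    split_ifs with h
    · subst h
      simpa using hperm (Equiv.swap i k) i i
    · obtain ⟨σ, rfl, rfl⟩ := exists_perm_pair hij h
      simp [hperm, hq]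
  have hD (d : n → ℂ) : B (diagonal d) (diagonal d) =
      q * (diagonal d).trace ^ 2 + (p - q) * (diagonal d * diagonal d).trace := by
    have hd : diagonal d = ∑ k, d k • single k k (1 : ℂ) := by
      simp [← sum_single_eq_diagonal, smul_single]
    have h : B (diagonal d) (diagonal d) =
        ∑ k, ∑ l, d l * (d k * (q + if l = k then p - q else 0)) := by
      simp only [hd, map_sum, map_smul, LinearMap.sum_apply, LinearMap.smul_apply, hE, smul_eq_mul,
        Finset.mul_sum]
      exact Finset.sum_congr rfl fun _ _ ↦ Finset.sum_congr rfl fun _ _ ↦ by ring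
    rw [h]
    simp only [mul_add, Finset.sum_add_distrib, mul_ite, mul_zero, Finset.sum_ite_eq',
      Finset.mem_univ, if_true, trace_diagonal, diagonal_mul_diagonal]
    rw [sq, Finset.sum_mul_sum, Finset.mul_sum, Finset.mul_sum]
    simp only [Finset.mul_sum]
    congr 1
    · exact Finset.sum_congr rfl fun _ _ ↦ Finset.sum_congr rfl fun _ _ ↦ by ring
    · exact Finset.sum_congr rfl fun _ _ ↦ by ring
  refine ⟨q, p - q, fun Y hY ↦ ?_⟩
  obtain ⟨V, hV, d, rfl⟩ : ∃ V ∈ Matrix.unitaryGroup n ℂ, ∃ d, Y = V * diagonal d * Vᴴ :=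
    ⟨hY.eigenvectorUnitary, SetLike.coe_mem _, _, hY.spectral_theorem⟩
  have hVV : Vᴴ * V = 1 := Matrix.mem_unitaryGroup_iff'.1 hV
  have hsq : V * diagonal d * Vᴴ * (V * diagonal d * Vᴴ) = 
      V * (diagonal d * diagonal d) * Vᴴ := by
    simp only [Matrix.mul_assoc, ← Matrix.mul_assoc Vᴴ V, hVV, Matrix.one_mul]
  have htr (M : Matrix n n ℂ) : (V * M * Vᴴ).trace = M.trace := by
    rw [trace_mul_cycle, hVV, Matrix.one_mul]
  rw [hB V hV, hD, hsq, htr, htr]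

lemma sum_apply_single_single {n : Type*} [DecidableEq n] [Fintype n]
    (B : Matrix n n ℂ →ₗ[ℂ] Matrix n n ℂ →ₗ[ℂ] ℂ) {a b : ℂ}
    (hB : ∀ Y : Matrix n n ℂ, Y.IsHermitian → B Y Y = a * Y.trace ^ 2 + b * (Y * Y).trace) :
    ∑ i, ∑ j, B (single i j 1) (single j i 1) =
      a * Fintype.card n + b * (Fintype.card n : ℂ) ^ 2 := by
  have key (i j : n) : B (single i j 1) (single j i 1) + B (single j i 1) (single i j 1) =
      2 * a * (if i = j then 1 else 0) + 2 * b := by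
    have h1 := hB (single i j 1 + single j i 1) (by simp [IsHermitian, add_comm])
    have h2 := hB (Complex.I • (single i j 1 - single j i 1))
      (by simp [IsHermitian, ← smul_neg])
    simp only [map_add, map_sub, map_smul, LinearMap.add_apply, LinearMap.sub_apply,
      LinearMap.smul_apply, smul_eq_mul, smul_mul_smul_comm, trace_smul, Matrix.add_mul,
      Matrix.mul_add, Matrix.sub_mul, Matrix.mul_sub, trace_add, trace_sub] at h1 h2
    by_cases hij : i = j
    · subst hij
      simp at h1 ⊢
      linear_combination h1 / 2
    · have hji : j ≠ i := Ne.symm hij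
      simp [hij, hji] at h1 h2 ⊢
      linear_combination (h1 + h2) / 2 -
        (B (single i j 1) (single i j 1) + B (single j i 1) (single j i 1) -
          B (single i j 1) (single j i 1) - B (single j i 1) (single i j 1)) / 2 * Complex.I_sq
  have hsum : ∑ i, ∑ j, B (single i j 1) (single j i 1) =
      ∑ i, ∑ j, B (single j i 1) (single i j 1) := Finset.sum_comm
  have h := Finset.sum_congr rfl fun i (_ : i ∈ Finset.univ) ↦
    Finset.sum_congr rfl fun j (_ : j ∈ Finset.univ) ↦ key i j
  simp only [Finset.sum_add_distrib, ← hsum] at h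
  simp at h
  linear_combination h / 2

instance (n : Type*) [DecidableEq n] [Fintype n] : CompactSpace (Matrix.unitaryGroup n ℂ) := by
  refine isCompact_iff_compactSpace.1 ?_
  refine IsCompact.of_isClosed_subset (isCompact_univ_pi fun _ ↦ isCompact_univ_pi fun _ ↦
    isCompact_closedBall (0 : ℂ) 1) isClosed_unitary fun U hU i _ j _ ↦ ?_
  simpa using entry_norm_bound_of_unitary hU i j

/-- The bilinear form `(A, B) ↦ Tr ([X, A] [B, X])`. -/
noncomputable def commTrace {n : Type*} [Fintype n] (X : Matrix n n ℂ) :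
    Matrix n n ℂ →ₗ[ℂ] Matrix n n ℂ →ₗ[ℂ] ℂ :=
  LinearMap.mk₂ ℂ (fun A B ↦ ((X * A - A * X) * (B * X - X * B)).trace)
    (fun _ _ _ ↦ by simp only [← trace_add]; congr 1; noncomm_ring)
    (fun _ _ _ ↦ by simp [← smul_sub])
    (fun _ _ _ ↦ by simp only [← trace_add]; congr 1; noncomm_ring)
    (fun _ _ _ ↦ by simp [← smul_sub])

lemma commTrace_apply {n : Type*} [Fintype n] (X A B : Matrix n n ℂ) :
    commTrace X A B = ((X * A - A * X) * (B * X - X * B)).trace := rfl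

lemma continuous_commTrace_conj {n : Type*} [DecidableEq n] [Fintype n] (X Y Z : Matrix n n ℂ) :
    Continuous fun U : Matrix.unitaryGroup n ℂ ↦
      commTrace X ((U : Matrix n n ℂ)ᴴ * Y * U) ((U : Matrix n n ℂ)ᴴ * Z * U) := by
  simp only [commTrace_apply]
  fun_prop

lemma integrable_commTrace_conj {n : Type*} [DecidableEq n] [Fintype n]
    (μ : Measure (Matrix.unitaryGroup n ℂ)) [IsFiniteMeasure μ] (X Y Z : Matrix n n ℂ) :
    Integrable (fun U : Matrix.unitaryGroup n ℂ ↦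
      commTrace X ((U : Matrix n n ℂ)ᴴ * Y * U) ((U : Matrix n n ℂ)ᴴ * Z * U)) μ :=
  (continuous_commTrace_conj X Y Z).integrable_of_hasCompactSupport (.of_compactSpace _)

/-- The Haar average of `commTrace X (U† Y U) (U† Z U)`. -/
noncomputable def haarCommTrace {n : Type*} [DecidableEq n] [Fintype n]
    (μ : Measure (Matrix.unitaryGroup n ℂ)) [IsFiniteMeasure μ] (X : Matrix n n ℂ) :
    Matrix n n ℂ →ₗ[ℂ] Matrix n n ℂ →ₗ[ℂ] ℂ :=
  LinearMap.mk₂ ℂ (fun Y Z ↦ ∫ U : Matrix.unitaryGroup n ℂ,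
      commTrace X ((U : Matrix n n ℂ)ᴴ * Y * U) ((U : Matrix n n ℂ)ᴴ * Z * U) ∂μ)
    (fun _ _ _ ↦ by
      rw [← integral_add (integrable_commTrace_conj ..) (integrable_commTrace_conj ..)]
      simp [Matrix.mul_add, Matrix.add_mul])
    (fun _ _ _ ↦ by rw [← integral_smul]; simp)
    (fun _ _ _ ↦ by
      rw [← integral_add (integrable_commTrace_conj ..) (integrable_commTrace_conj ..)]
      simp [Matrix.mul_add, Matrix.add_mul])
    (fun _ _ _ ↦ by rw [← integral_smul]; simp)

lemma haarCommTrace_apply {n : Type*} [DecidableEq n] [Fintype n]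
    (μ : Measure (Matrix.unitaryGroup n ℂ)) [IsFiniteMeasure μ] (X Y Z : Matrix n n ℂ) :
    haarCommTrace μ X Y Z = ∫ U : Matrix.unitaryGroup n ℂ,
      commTrace X ((U : Matrix n n ℂ)ᴴ * Y * U) ((U : Matrix n n ℂ)ᴴ * Z * U) ∂μ := rfl

lemma haarCommTrace_conj {n : Type*} [DecidableEq n] [Fintype n]
    (μ : Measure (Matrix.unitaryGroup n ℂ)) [IsFiniteMeasure μ] [μ.IsMulLeftInvariant]
    (X : Matrix n n ℂ) (V : Matrix n n ℂ) (hV : V ∈ Matrix.unitaryGroup n ℂ)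
    (Y Z : Matrix n n ℂ) :
    haarCommTrace μ X (V * Y * Vᴴ) (V * Z * Vᴴ) = haarCommTrace μ X Y Z := by
  let W : Matrix.unitaryGroup n ℂ := ⟨V, hV⟩
  rw [haarCommTrace_apply, haarCommTrace_apply, ← integral_mul_left_eq_self _ W]
  refine integral_congr_ae (.of_forall fun U ↦ ?_)
  have hVV : Vᴴ * V = 1 := Matrix.mem_unitaryGroup_iff'.1 hV
  have hW : ((W * U : Matrix.unitaryGroup n ℂ) : Matrix n n ℂ) = V * U := rfl
  simp only [hW, conjTranspose_mul, Matrix.mul_assoc, ← Matrix.mul_assoc Vᴴ V, hVV,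
    Matrix.one_mul]

lemma sum_conj_single_mul_conj_single {n : Type*} [DecidableEq n] [Fintype n]
    {U : Matrix n n ℂ} (hU : U ∈ Matrix.unitaryGroup n ℂ) (M : Matrix n n ℂ) :
    ∑ i, ∑ j, Uᴴ * single i j 1 * U * M * (Uᴴ * single j i 1 * U) = M.trace • 1 := by
  have hUU : Uᴴ * U = 1 := Matrix.mem_unitaryGroup_iff'.1 hU
  have h (i j : n) : Uᴴ * single i j 1 * U * M * (Uᴴ * single j i 1 * U) =
      Uᴴ * single i i ((U * M * Uᴴ) j j) * U := by
    have := single_mul_mul_single i j j i (1 : ℂ) (U * M * Uᴴ) 1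
    simp only [one_mul, mul_one] at this
    rw [← this]
    simp only [Matrix.mul_assoc]
  have ht : ∑ j, (U * M * Uᴴ) j j = M.trace := by
    change (U * M * Uᴴ).trace = _
    rw [trace_mul_cycle, hUU, Matrix.one_mul]
  have hs (i : n) : ∑ j, single i i ((U * M * Uᴴ) j j) = single i i M.trace := by
    rw [← ht]
    exact (map_sum (singleLinearMap ℂ i i : ℂ →ₗ[ℂ] Matrix n n ℂ) _ _).symm
  simp only [h, ← Matrix.sum_mul, ← Matrix.mul_sum, hs]
  rw [sum_single_eq_diagonal, ← smul_one_eq_diagonal]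
  simp [hUU]

lemma sum_commTrace_conj_single {n : Type*} [DecidableEq n] [Fintype n]
    {U : Matrix n n ℂ} (hU : U ∈ Matrix.unitaryGroup n ℂ) (X : Matrix n n ℂ) :
    ∑ i, ∑ j, commTrace X (Uᴴ * single i j 1 * U) (Uᴴ * single j i 1 * U) =
      2 * (Fintype.card n * (X * X).trace - X.trace ^ 2) := by
  have h (A B : Matrix n n ℂ) : commTrace X A B =
      (X * (A * 1 * B) * X).trace - (X * (A * X * B)).trace - (A * X * B * X).trace
        + (A * (X * X) * B).trace := by
    rw [commTrace_apply, ← trace_sub, ← trace_sub, ← trace_add]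
    congr 1
    noncomm_ring
  simp only [h, Finset.sum_add_distrib, Finset.sum_sub_distrib, ← trace_sum, ← Matrix.mul_sum,
    ← Matrix.sum_mul, sum_conj_single_mul_conj_single hU]
  simp
  ring

lemma sum_haarCommTrace_single {n : Type*} [DecidableEq n] [Fintype n]
    (μ : Measure (Matrix.unitaryGroup n ℂ)) [IsProbabilityMeasure μ] (X : Matrix n n ℂ) :
    ∑ i, ∑ j, haarCommTrace μ X (single i j 1) (single j i 1) =
      2 * (Fintype.card n * (X * X).trace - X.trace ^ 2) := by
  simp only [haarCommTrace_apply]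
  simp_rw [← integral_finsetSum _ fun _ _ ↦ integrable_commTrace_conj μ X _ _]
  rw [← integral_finsetSum _ fun _ _ ↦ integrable_finsetSum _ fun _ _ ↦
    integrable_commTrace_conj μ X _ _]
  simp [sum_commTrace_conj_single (SetLike.coe_mem _)]

lemma haarCommTrace_one {n : Type*} [DecidableEq n] [Fintype n]
    (μ : Measure (Matrix.unitaryGroup n ℂ)) [IsFiniteMeasure μ] (X : Matrix n n ℂ) :
    haarCommTrace μ X 1 1 = 0 := by
  have h (U : Matrix.unitaryGroup n ℂ) : (U : Matrix n n ℂ)ᴴ * U = 1 :=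
    Matrix.mem_unitaryGroup_iff'.1 U.2
  simp [haarCommTrace_apply, commTrace_apply, h]

lemma trace_riemannGrad1 {N : ℕ} {X Y : Matrix (Fin N) (Fin N) ℂ} (hX : X.IsHermitian)
    (hY : Y.IsHermitian) (U : Matrix.unitaryGroup (Fin N) ℂ) :
    ((riemannGrad1 N X Y U)ᴴ * riemannGrad1 N X Y U).trace =
      commTrace X ((U : Matrix (Fin N) (Fin N) ℂ)ᴴ * Y * U)
        ((U : Matrix (Fin N) (Fin N) ℂ)ᴴ * Y * U) := by
  have h : (U : Matrix (Fin N) (Fin N) ℂ) * (U : Matrix (Fin N) (Fin N) ℂ)ᴴ = 1 :=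
    Matrix.mem_unitaryGroup_iff.1 U.2
  have h' : (U : Matrix (Fin N) (Fin N) ℂ)ᴴ * U = 1 := Matrix.mem_unitaryGroup_iff'.1 U.2
  set A := (U : Matrix (Fin N) (Fin N) ℂ)ᴴ * Y * U with hA
  have hg : riemannGrad1 N X Y U = U * (A * X - X * A) := by
    simp only [riemannGrad1, hA, Matrix.mul_sub, ← Matrix.mul_assoc, h, Matrix.one_mul]
  have hAh : Aᴴ = A := by simp [hA, hY.eq, Matrix.mul_assoc]
  rw [hg, commTrace_apply, conjTranspose_mul, Matrix.mul_assoc,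
    ← Matrix.mul_assoc (U : Matrix (Fin N) (Fin N) ℂ)ᴴ, h', Matrix.one_mul, conjTranspose_sub,
    conjTranspose_mul A X, conjTranspose_mul X A, hAh, hX.eq]

lemma trace_centered_mul_self {N : ℕ} (hN : N ≠ 0) (X : Matrix (Fin N) (Fin N) ℂ) :
    ((X - (X.trace / N) • (1 : Matrix (Fin N) (Fin N) ℂ)) *
      (X - (X.trace / N) • (1 : Matrix (Fin N) (Fin N) ℂ))).trace =
      (X * X).trace - X.trace ^ 2 / N := by
  have : (N : ℂ) ≠ 0 := Nat.cast_ne_zero.2 hN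
  simp [Matrix.mul_sub, Matrix.sub_mul]
  field_simp
  ring

/-- Haar-variance of the Riemannian gradient for `E(U) = Tr(X U† Y U)` with Hermitian `X`, `Y`:
`(1/N) ∫ Tr(g†g) dμ = (2/(N²−1)) Tr((X − (Tr X/N)·1)²) Tr((Y − (Tr Y/N)·1)²)`. -/
theorem riemannGrad_variance (N : ℕ) (hN : 2 ≤ N)
    (μ : Measure (Matrix.unitaryGroup (Fin N) ℂ))
    [μ.IsHaarMeasure] [IsProbabilityMeasure μ]
    (X Y : Matrix (Fin N) (Fin N) ℂ) (hX : X.IsHermitian) (hY : Y.IsHermitian) :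
    (1 / (N : ℂ)) * ∫ U, ((riemannGrad1 N X Y U)ᴴ * riemannGrad1 N X Y U).trace ∂μ
      = (2 / ((N : ℂ) ^ 2 - 1)) *
          ((X - (X.trace / N) • (1 : Matrix (Fin N) (Fin N) ℂ)) *
            (X - (X.trace / N) • (1 : Matrix (Fin N) (Fin N) ℂ))).trace *
          ((Y - (Y.trace / N) • (1 : Matrix (Fin N) (Fin N) ℂ)) *
            (Y - (Y.trace / N) • (1 : Matrix (Fin N) (Fin N) ℂ))).trace := by
  have : Nontrivial (Fin N) := Fin.nontrivial_iff_two_le.2 hN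
  have hN0 : (N : ℂ) ≠ 0 := Nat.cast_ne_zero.2 (by lia)
  have hN1 : (N : ℂ) ^ 2 - 1 ≠ 0 := by
    rw [sub_ne_zero]
    norm_cast
    nlinarith
  obtain ⟨a, b, hab⟩ := exists_apply_self_eq_of_unitary_invariant (haarCommTrace μ X)
    (haarCommTrace_conj μ X)
  have hsum := sum_apply_single_single _ hab
  have hone := hab 1 isHermitian_one
  rw [sum_haarCommTrace_single] at hsum
  simp only [haarCommTrace_one, Matrix.one_mul, trace_one, Fintype.card_fin] at hsum hone
  have hb : b = 2 * (N * (X * X).trace - X.trace ^ 2) / (N ^ 2 - 1) := by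
    rw [eq_div_iff hN1]
    refine mul_left_cancel₀ hN0 ?_
    linear_combination hone - N * hsum
  have ha : a = -b / N := by
    field_simp
    refine mul_left_cancel₀ hN0 ?_
    linear_combination -hone
  simp only [trace_riemannGrad1 hX hY, ← haarCommTrace_apply,
    trace_centered_mul_self (show N ≠ 0 by lia), hab Y hY, ha, hb]
  field_simp
  ring
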